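/- arXiv:2311.11639 — 2 statements merged into one kernel-verified Lean document; each statement's English description precedes it below -/
import Mathlib

section
/- Let G = (V, E) be a finite simple graph whose vertices can be linearly ordered so that no vertex is preceded (in the order) by more than two of its neighbors. Then there exist nine Pauli strings B_1, …, B_9 : V → {X, Y, Z} such that for every edge (u, v) ∈ E the nine pairs (B_k(u), B_k(v)), k = 1, …, 9, exactly cover {X, Y, Z}² (i.e., the map k ↦ (B_k(u), B_k(v)) is a bijection from {1, …, 9} onto {X, Y, Z} × {X, Y, Z}). -/
/-- Three pairwise independent linear functionals on `(ZMod 3)²`, with `k = 3 * x + y`. -/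
def pauliFun (k : Fin 9) (c : Fin 3) : Fin 3 :=
  if c = 0 then Fin.ofNat 3 (k.val / 3)
  else if c = 1 then Fin.ofNat 3 k.val
  else Fin.ofNat 3 (k.val / 3 + k.val)

lemma pauliFun_inj : ∀ a b : Fin 3, a ≠ b → ∀ k l : Fin 9,
    pauliFun k a = pauliFun l a → pauliFun k b = pauliFun l b → k = l := by
  decide

/-- Greedy colouring: a graph with at most two earlier neighbours per vertex is 3-colourable. -/
lemma exists_three_coloring {V : Type*} [Fintype V] [DecidableEq V]
    (G : SimpleGraph V) [DecidableRel G.Adj] (f : V ≃ Fin (Fintype.card V))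
    (hf : ∀ v : V, (Finset.univ.filter fun u => G.Adj u v ∧ f u < f v).card ≤ 2) (n : ℕ) :
    ∃ c : V → Fin 3, ∀ u v, G.Adj u v → f u < f v → (f v).val < n → c u ≠ c v := by
  induction n with
  | zero => exact ⟨fun _ => 0, fun u v _ _ h => absurd h (Nat.not_lt_zero _)⟩
  | succ n ih =>
    obtain ⟨c, hc⟩ := ih
    by_cases hn : n < Fintype.card V
    · obtain ⟨w, hw⟩ := f.surjective ⟨n, hn⟩
      have hwn : (f w).val = n := by rw [hw]
      obtain ⟨a, ha⟩ : ∃ a : Fin 3,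
          a ∉ (Finset.univ.filter fun u => G.Adj u w ∧ f u < f w).image c := by
        by_contra! hall
        have h1 := Finset.card_le_card
          (fun a _ => hall a : (Finset.univ : Finset (Fin 3)) ⊆ _)
        have h2 := h1.trans (Finset.card_image_le.trans (hf w))
        simp at h2
      refine ⟨Function.update c w a, fun u v huv hlt hv => ?_⟩
      have huw : u ≠ w := by
        rintro rfl
        have := Fin.lt_def.mp hlt
        omega
      rw [Function.update_of_ne huw]
      by_cases hvw : v = w
      · subst hvw
        rw [Function.update_self]
        rintro rfl
        exact ha (Finset.mem_image_of_mem c (by simp [huv, hlt]))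
      · rw [Function.update_of_ne hvw]
        refine hc u v huv hlt ?_
        have : (f v).val ≠ n := fun e => hvw (f.injective (Fin.ext (e.trans hwn.symm)))
        omega
    · exact ⟨c, fun u v huv hlt _ => hc u v huv hlt (by omega)⟩

/-- **Theorem SIV.4 of van den Berg et al. (Theorem 1 of the paper).**
If the vertices of a finite simple graph `G` can be linearly ordered (here: via an
equivalence with `Fin (card V)`) so that no vertex is preceded by more than two of its
neighbors, then there exist nine Pauli strings `B 1, …, B 9 : V → {X, Y, Z}` (Pauli labels
modeled as `Fin 3`) such that for every edge `(u, v)` the map `k ↦ (B k u, B k v)` is a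
bijection from `Fin 9` onto `{X, Y, Z} × {X, Y, Z}`. -/
theorem nine_pauli_strings_of_ordering
    {V : Type*} [Fintype V] [DecidableEq V]
    (G : SimpleGraph V) [DecidableRel G.Adj]
    (h : ∃ f : V ≃ Fin (Fintype.card V),
      ∀ v : V, (Finset.univ.filter fun u => G.Adj u v ∧ f u < f v).card ≤ 2) :
    ∃ B : Fin 9 → V → Fin 3,
      ∀ u v : V, G.Adj u v →
        Function.Bijective (fun k : Fin 9 => (B k u, B k v)) := by
  obtain ⟨f, hf⟩ := h
  obtain ⟨c, hc⟩ := exists_three_coloring G f hf (Fintype.card V)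
  refine ⟨fun k v => pauliFun k (c v), fun u v huv => ?_⟩
  have hne : c u ≠ c v := by
    rcases lt_trichotomy (f u) (f v) with h | h | h
    · exact hc u v huv h (f v).isLt
    · exact absurd (f.injective h) huv.ne
    · exact (hc v u huv.symm h (f u).isLt).symm
  rw [Fintype.bijective_iff_injective_and_card]
  refine ⟨fun k l hkl => ?_, by simp⟩
  have hkl' := Prod.mk.inj hkl
  exact pauliFun_inj _ _ hne k l hkl'.1 hkl'.2
end

section
/- Let N ≥ 4 and let K_N be the complete graph on N vertices (the fully connected qubit topology). Then there exist m = 3·(1 + 2·⌈log₂(N − 2)⌉) Pauli strings B_1, …, B_m : Fin N → {X, Y, Z} such that for every pair of distinct vertices u, v the pairs (B_k(u), B_k(v)), k = 1, …, m, cover all of {X, Y, Z}² (i.e., the map k ↦ (B_k(u), B_k(v)) is surjective onto {X, Y, Z} × {X, Y, Z}). -/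
/-- The orthogonal array with nine rows and four columns over `Fin 3`. -/
lemma pauli_four : ∃ B : Fin 9 → Fin 4 → Fin 3, ∀ u v : Fin 4, u ≠ v →
    ∀ p : Fin 3 × Fin 3, ∃ k, (B k u, B k v) = p := by
  let x : Fin 9 → Fin 3 := fun k => Fin.ofNat 3 k.val
  let y : Fin 9 → Fin 3 := fun k => Fin.ofNat 3 (k.val / 3)
  refine ⟨fun k => ![x k, y k, x k + y k, x k + y k + y k], ?_⟩
  decide

/-- A nonzero difference, up to sign, realizes every pair of distinct labels. -/
lemma pauli_sign : ∀ a b p q : Fin 3, a ≠ b → p ≠ q →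
    (∃ c, c + a = p ∧ c + b = q) ∨ (∃ c, c - a = p ∧ c - b = q) := by
  decide

lemma pauli_general (N L : ℕ) (h : N ≤ 3 ^ L) :
    ∃ B : Fin (3 * (1 + 2 * L)) → Fin N → Fin 3,
      ∀ u v : Fin N, u ≠ v →
        Function.Surjective (fun k => (B k u, B k v)) := by
  obtain ⟨e⟩ : Nonempty (Fin N ↪ (Fin L → Fin 3)) :=
    Function.Embedding.nonempty_of_card_le (by simpa using h)
  have E : Fin (3 * (1 + 2 * L)) ≃ Fin 3 × (Unit ⊕ (Bool × Fin L)) :=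
    Fintype.equivOfCardEq (by simp)
  let C : Fin 3 × (Unit ⊕ (Bool × Fin L)) → Fin N → Fin 3 := fun k u =>
    match k with
    | (c, .inl _) => c
    | (c, .inr (true, i)) => c + e u i
    | (c, .inr (false, i)) => c - e u i
  refine ⟨fun k => C (E k), fun u v huv => ?_⟩
  rintro ⟨p, q⟩
  suffices hk : ∃ k, C k u = p ∧ C k v = q by
    obtain ⟨k, h1, h2⟩ := hk
    exact ⟨E.symm k, by simp [h1, h2]⟩
  by_cases hpq : p = q
  · exact ⟨(p, .inl ()), rfl, hpq⟩
  · obtain ⟨i, hi⟩ := Function.ne_iff.mp (e.injective.ne huv)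
    rcases pauli_sign _ _ p q hi hpq with ⟨c, h1, h2⟩ | ⟨c, h1, h2⟩
    · exact ⟨(c, .inr (true, i)), h1, h2⟩
    · exact ⟨(c, .inr (false, i)), h1, h2⟩

lemma pauli_pow (L : ℕ) (hL : 2 ≤ L) : 2 ^ L + 2 ≤ 3 ^ L := by
  induction L, hL using Nat.le_induction with
  | base => norm_num
  | succ n _ ih => rw [pow_succ, pow_succ]; omega

/-- **Theorem 3 of the paper.**
For the complete graph `K_N` on `N ≥ 4` vertices there exist
`m = 3 * (1 + 2 * ⌈log₂ (N - 2)⌉)` Pauli strings `B k : Fin N → {X, Y, Z}` (Pauli labels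
modeled as `Fin 3`, the ceiling base-2 logarithm as `Nat.clog 2`) such that for every pair
of distinct vertices `u, v` the map `k ↦ (B k u, B k v)` is surjective onto
`{X, Y, Z} × {X, Y, Z}`. -/
theorem pauli_strings_complete_graph (N : ℕ) (hN : 4 ≤ N) :
    ∃ B : Fin (3 * (1 + 2 * Nat.clog 2 (N - 2))) → Fin N → Fin 3,
      ∀ u v : Fin N, u ≠ v →
        Function.Surjective (fun k => (B k u, B k v)) := by
  rcases hN.eq_or_lt with rfl | h5
  · have h : 3 * (1 + 2 * Nat.clog 2 (4 - 2)) = 9 := by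
      have : Nat.clog 2 2 = 1 := by simpa using Nat.clog_pow 2 1 (by norm_num)
      simp [this]
    rw [h]
    exact pauli_four
  · apply pauli_general
    have h1 : N - 2 ≤ 2 ^ Nat.clog 2 (N - 2) := Nat.le_pow_clog (by norm_num) _
    have h2 : 2 ≤ Nat.clog 2 (N - 2) := by
      by_contra hlt
      have : 2 ^ Nat.clog 2 (N - 2) ≤ 2 ^ 1 := Nat.pow_le_pow_right (by norm_num) (by omega)
      omega
    have := pauli_pow _ h2
    omega
end
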